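/- Let n = 2^m with m ≥ 2, and let F_n be the family of functions f : F_2^n → F_2 such that f(0) = 0, f(1) = 1, and f(ρ(x)) = f(x) ⊕ 1 for all x ∈ F_2^n \ {0, 1}. If f ∈ F_n, then the function g : F_2^{n/2} → F_2 defined by g(y) = f(y, y) belongs to F_{n/2}, and for every integer k, NL_{E_{n,2k}}(f) ≥ NL_{E_{n/2,k}}(g). Consequently, for every k, the minimum of NL_{E_{n,2k}} over F_n is at least the minimum of NL_{E_{n/2,k}} over F_{n/2}. -/

import Mathlib

/-- Left cyclic shift on `F_2^n`: `(rho x) i = x ((i+1) mod n)`. -/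
def rho {n : ℕ} (x : Fin n → ZMod 2) : Fin n → ZMod 2 :=
  fun i => x ⟨(i.val + 1) % n, Nat.mod_lt _ i.pos⟩

/-- Inner product over `F_2`. -/
def dot {n : ℕ} (a x : Fin n → ZMod 2) : ZMod 2 := ∑ i, a i * x i

/-- The slice `E_{n,k}` of vectors of Hamming weight `k`. -/
def E (n k : ℕ) : Finset (Fin n → ZMod 2) :=
  Finset.univ.filter (fun x => hammingNorm x = k)

/-- Nonlinearity of `f` restricted to a finite set `S ⊆ F_2^n`:
the minimum over affine functions `x ↦ a·x ⊕ ε` of the number of disagreements on `S`. -/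
noncomputable def NL {n : ℕ} (f : (Fin n → ZMod 2) → ZMod 2)
    (S : Finset (Fin n → ZMod 2)) : ℕ :=
  sInf {m : ℕ | ∃ a : Fin n → ZMod 2, ∃ ε : ZMod 2,
    m = (S.filter (fun x => f x ≠ dot a x + ε)).card}

/-- The family `F_N` of functions `f` with `f(0)=0`, `f(1)=1` and
`f(ρ(x)) = f(x) ⊕ 1` for all `x ∉ {0,1}`. -/
def Fam (N : ℕ) (f : (Fin N → ZMod 2) → ZMod 2) : Prop :=
  f 0 = 0 ∧ f 1 = 1 ∧
    ∀ x : Fin N → ZMod 2, x ≠ 0 → x ≠ 1 → f (rho x) = f x + 1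

/-- Concatenation `(y, y)` of a vector with itself. -/
def dup {t : ℕ} (y : Fin t → ZMod 2) : Fin (2 * t) → ZMod 2 :=
  fun i => y ⟨i.val % t, Nat.mod_lt _ (by have := i.isLt; omega)⟩

theorem sum_two_mul {M : Type*} [AddCommMonoid M] {t : ℕ} (h : Fin (2 * t) → M) :
    ∑ i, h i = ∑ j : Fin t, (h ⟨j.val, by omega⟩ + h ⟨t + j.val, by omega⟩) := by
  rw [← (finProdFinEquiv (m := 2) (n := t)).sum_comp, Fintype.sum_prod_type, Fin.sum_univ_two,
    Finset.sum_add_distrib]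
  congr 1
  refine Finset.sum_congr rfl fun j _ => congrArg h (Fin.ext ?_)
  simp [finProdFinEquiv, add_comm]

theorem dup_lo {t : ℕ} (y : Fin t → ZMod 2) (j : Fin t) : dup y ⟨j.val, by omega⟩ = y j := by
  unfold dup
  congr 1
  exact Fin.ext (Nat.mod_eq_of_lt j.isLt)

theorem dup_hi {t : ℕ} (y : Fin t → ZMod 2) (j : Fin t) : dup y ⟨t + j.val, by omega⟩ = y j := by
  unfold dup
  congr 1
  apply Fin.ext
  simp [Nat.mod_eq_of_lt j.isLt]

theorem dup_inj {t : ℕ} : Function.Injective (dup (t := t)) := by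
  intro y z h
  funext j
  rw [← dup_lo y j, h, dup_lo]

theorem norm_dup {t : ℕ} (y : Fin t → ZMod 2) : hammingNorm (dup y) = 2 * hammingNorm y := by
  unfold hammingNorm
  rw [Finset.card_filter, Finset.card_filter, sum_two_mul, Finset.mul_sum]
  refine Finset.sum_congr rfl fun j _ => ?_
  simp only [dup_lo, dup_hi]
  ring

theorem dot_dup {t : ℕ} (a : Fin (2 * t) → ZMod 2) (y : Fin t → ZMod 2) :
    dot a (dup y) =
      dot (fun j : Fin t => a ⟨j.val, by omega⟩ + a ⟨t + j.val, by omega⟩) y := by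
  unfold dot
  rw [sum_two_mul]
  refine Finset.sum_congr rfl fun j _ => ?_
  rw [dup_lo, dup_hi, add_mul]

theorem rho_dup {t : ℕ} (y : Fin t → ZMod 2) : rho (dup y) = dup (rho y) := by
  funext i
  unfold rho dup
  congr 1
  apply Fin.ext
  simp

theorem NL_dup {t k : ℕ} (f : (Fin (2 * t) → ZMod 2) → ZMod 2) :
    NL (fun y : Fin t → ZMod 2 => f (dup y)) (E t k) ≤ NL f (E (2 * t) (2 * k)) := by
  have hne : {m : ℕ | ∃ a : Fin (2 * t) → ZMod 2, ∃ ε : ZMod 2,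
    m = ((E (2 * t) (2 * k)).filter (fun x => f x ≠ dot a x + ε)).card}.Nonempty :=
    ⟨_, 0, 0, rfl⟩
  obtain ⟨a, ε, h⟩ := Nat.sInf_mem hne
  unfold NL
  rw [h]
  refine le_trans (Nat.sInf_le ⟨fun j : Fin t => a ⟨j.val, by omega⟩ + a ⟨t + j.val, by omega⟩, ε, rfl⟩)
    (Finset.card_le_card_of_injOn dup ?_ dup_inj.injOn)
  · intro y hy
    simp only [E, Finset.coe_filter, Finset.mem_filter, Finset.mem_univ, true_and,
      Set.mem_ofPred_eq] at hy ⊢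
    rw [norm_dup, dot_dup]
    exact ⟨by omega, hy.2⟩

theorem Fam_dup {t : ℕ} (f : (Fin (2 * t) → ZMod 2) → ZMod 2) (hf : Fam (2 * t) f) :
    Fam t (fun y => f (dup y)) := by
  obtain ⟨h0, h1, h2⟩ := hf
  refine ⟨h0, h1, fun y y0 y1 => ?_⟩
  show f (dup (rho y)) = f (dup y) + 1
  rw [← rho_dup]
  exact h2 _ (fun h => y0 (dup_inj h)) (fun h => y1 (dup_inj h))

theorem rho_iter {n : ℕ} (x : Fin n → ZMod 2) (j : ℕ) (i : Fin n) :
    (rho^[j] x) i = x ⟨(i.val + j) % n, Nat.mod_lt _ i.pos⟩ := by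
  induction j generalizing x with
  | zero => simp [Nat.mod_eq_of_lt i.isLt]
  | succ j ih =>
    rw [Function.iterate_succ_apply, ih]
    unfold rho
    congr 1
    apply Fin.ext
    simp [add_assoc]

theorem rho_iter_n {n : ℕ} (x : Fin n → ZMod 2) : rho^[n] x = x := by
  funext i
  rw [rho_iter]
  congr 1
  apply Fin.ext
  simp [Nat.mod_eq_of_lt i.isLt]

theorem rho_inj {n : ℕ} (hn : 0 < n) : Function.Injective (rho (n := n)) := by
  intro x y h
  obtain ⟨k, rfl⟩ : ∃ k, n = k + 1 := ⟨n - 1, by omega⟩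
  rw [← rho_iter_n x, ← rho_iter_n y, Function.iterate_succ_apply, h,
    ← Function.iterate_succ_apply]

theorem rho_fix {n : ℕ} (x : Fin n → ZMod 2) (h : rho x = x) : x = 0 ∨ x = 1 := by
  rcases Nat.eq_zero_or_pos n with rfl | hn
  · left; exact Subsingleton.elim _ _
  have hc : ∀ i : Fin n, x i = x ⟨0, hn⟩ := by
    intro i
    have := congrFun (Function.iterate_fixed h i.val) ⟨0, hn⟩
    rw [rho_iter] at this
    rw [← this]
    congr 1
    apply Fin.ext
    simp [Nat.mod_eq_of_lt i.isLt]
  have h2 : ∀ z : ZMod 2, z = 0 ∨ z = 1 := by decide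
  rcases h2 (x ⟨0, hn⟩) with h0 | h0
  · left; funext i; rw [hc, h0]; rfl
  · right; funext i; rw [hc, h0]; rfl

theorem Fam_nonempty (m n : ℕ) (hn : n = 2 ^ m) : ∃ f, Fam n f := by
  classical
  have hpos : 0 < n := by rw [hn]; positivity
  obtain ⟨σ, hσ⟩ : ∃ σ : Equiv.Perm (Fin n → ZMod 2), ∀ x, σ x = rho x :=
    ⟨Equiv.ofBijective rho (Finite.injective_iff_bijective.mp (rho_inj hpos)), fun x => rfl⟩
  have hσn : σ ^ n = 1 := by
    ext1 x
    rw [Equiv.Perm.coe_pow, show (σ : (Fin n → ZMod 2) → _) = rho from funext hσ, rho_iter_n]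
    rfl
  let s := Equiv.Perm.SameCycle.setoid σ
  let r : (Fin n → ZMod 2) → (Fin n → ZMod 2) := fun x => (Quotient.mk s x).out
  have hr : ∀ x, ∃ j : ℤ, (σ ^ j) (r x) = x := fun x => Quotient.mk_out (s := s) x
  have hrσ : ∀ x, r (σ x) = r x := by
    intro x
    have : (Quotient.mk s (σ x)) = Quotient.mk s x :=
      Quotient.sound (s := s) (show σ.SameCycle (σ x) x from ⟨-1, by simp⟩)
    simp only [r, this]
  choose j hj using hr
  have h01 : (0 : Fin n → ZMod 2) ≠ 1 := fun h => by
    have := congrFun h ⟨0, hpos⟩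
    simp at this
  refine ⟨fun x => if x = 0 then 0 else if x = 1 then 1 else (j x : ZMod 2), by simp,
    by simp [h01.symm], fun x x0 x1 => ?_⟩
  have r0 : rho (0 : Fin n → ZMod 2) = 0 := rfl
  have r1 : rho (1 : Fin n → ZMod 2) = 1 := rfl
  have y0 : rho x ≠ 0 := fun h => x0 (rho_inj hpos (h.trans r0.symm))
  have y1 : rho x ≠ 1 := fun h => x1 (rho_inj hpos (h.trans r1.symm))
  simp only [x0, x1, y0, y1, if_false]
  rw [← hσ]
  have e1 : (σ ^ (j (σ x))) (r x) = (σ ^ (1 + j x)) (r x) := by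
    have := hj (σ x)
    rw [hrσ] at this
    rw [this, zpow_add, Equiv.Perm.mul_apply, hj, zpow_one]
  have e2 : (σ ^ (j (σ x) - (1 + j x))) (r x) = r x := by
    rw [sub_eq_neg_add, zpow_add, Equiv.Perm.mul_apply, e1, ← Equiv.Perm.mul_apply, ← zpow_add]
    simp
  have hev : Even (j (σ x) - (1 + j x)) := by
    by_contra ho
    rw [Int.not_even_iff_odd] at ho
    have hc : IsCoprime (j (σ x) - (1 + j x)) ((2 : ℤ) ^ m) := by
      apply IsCoprime.pow_right
      obtain ⟨c, hc⟩ := ho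
      exact ⟨1, -c, by rw [hc]; ring⟩
    obtain ⟨u, v, huv⟩ := hc
    have hfix : σ (r x) = r x := by
      have h1 : σ ^ (v * 2 ^ m) = 1 := by
        have : ((2 : ℤ) ^ m) = (n : ℤ) := by rw [hn]; push_cast; rfl
        rw [this, mul_comm, zpow_mul, zpow_natCast, hσn, one_zpow]
      have h2 : (σ ^ (u * (j (σ x) - (1 + j x)))) (r x) = r x := by
        rw [mul_comm, zpow_mul]
        exact Equiv.Perm.zpow_apply_eq_self_of_apply_eq_self e2 u
      calc σ (r x) = (σ ^ (1 : ℤ)) (r x) := by rw [zpow_one]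
        _ = r x := by rw [← huv, zpow_add, h1, mul_one, h2]
    have hx : x = r x := by
      have := hj x
      rw [Equiv.Perm.zpow_apply_eq_self_of_apply_eq_self hfix] at this
      exact this.symm
    rw [← hx, hσ] at hfix
    rcases rho_fix x hfix with h | h
    · exact x0 h
    · exact x1 h
  have := (ZMod.intCast_zmod_eq_zero_iff_dvd _ 2).mpr (by exact_mod_cast hev.two_dvd)
  push_cast at this
  linear_combination this


theorem stmt_15 (m : ℕ) (hm : 2 ≤ m) (t : ℕ) (ht : t = 2 ^ (m - 1)) (k : ℕ) :
    (∀ f : (Fin (2 * t) → ZMod 2) → ZMod 2, Fam (2 * t) f →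
      Fam t (fun y => f (dup y)) ∧
      NL (fun y : Fin t → ZMod 2 => f (dup y)) (E t k)
        ≤ NL f (E (2 * t) (2 * k))) ∧
    sInf {v : ℕ | ∃ g : (Fin t → ZMod 2) → ZMod 2, Fam t g ∧ v = NL g (E t k)}
      ≤ sInf {v : ℕ | ∃ f : (Fin (2 * t) → ZMod 2) → ZMod 2,
          Fam (2 * t) f ∧ v = NL f (E (2 * t) (2 * k))} := by
  refine ⟨fun f hf => ⟨Fam_dup f hf, NL_dup f⟩, ?_⟩
  have hne : {v : ℕ | ∃ f : (Fin (2 * t) → ZMod 2) → ZMod 2,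
          Fam (2 * t) f ∧ v = NL f (E (2 * t) (2 * k))}.Nonempty := by
    obtain ⟨f, hf⟩ := Fam_nonempty m (2 * t) (by
      rw [ht, ← pow_succ']
      congr 1
      omega)
    exact ⟨_, f, hf, rfl⟩
  obtain ⟨f, hf, h⟩ := Nat.sInf_mem hne
  rw [h]
  exact le_trans (Nat.sInf_le ⟨_, Fam_dup f hf, rfl⟩) (NL_dup f)
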